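/- (Natural Left Join Reduction.) Let R1 and R2 be relations over attribute sets U1 and U2 and let K = U1 ∩ U2. If δπ_K R1 ⊆ π_K R2, then σ_{⋀_{u∈K} ¬isNull(u)} R1 ⟕ R2 ≡ R1 ⋈ R2, where σ_{⋀_{u∈K} ¬isNull(u)} keeps the tuples of R1 in which every attribute of K is non-null. -/

import Mathlib

noncomputable section
open Classical

attribute [local instance 10] Classical.propDecidable

namespace RA

variable {A Δ : Type} [DecidableEq A] [DecidableEq Δ]

/-- Three-valued logic: true, false, unknown (error). -/
inductive TV where
  | tt | ff | unk
deriving DecidableEq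

/-- Kleene conjunction. -/
def TV.and : TV → TV → TV
  | .ff, _ => .ff
  | _, .ff => .ff
  | .tt, .tt => .tt
  | _, _ => .unk

/-- Kleene negation. -/
def TV.not : TV → TV
  | .tt => .ff
  | .ff => .tt
  | .unk => .unk

mutual
/-- Terms over attributes `A` and domain `Δ`: attributes, constants and conditionals. -/
inductive Term (A Δ : Type) where
  | attr : A → Term A Δ
  | const : Δ → Term A Δ
  | ite : Filter A Δ → Term A Δ → Term A Δ → Term A Δ

/-- RA filters: `isNull` on a (finite) set of terms, equality, conjunction, negation. -/
inductive Filter (A Δ : Type) where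
  | isNull : List (Term A Δ) → Filter A Δ
  | eq : Term A Δ → Term A Δ → Filter A Δ
  | and : Filter A Δ → Filter A Δ → Filter A Δ
  | not : Filter A Δ → Filter A Δ
end

/-- Disjunction: `F1 ∨ F2 = ¬(¬F1 ∧ ¬F2)`. -/
def Filter.or (F1 F2 : Filter A Δ) : Filter A Δ := .not ((Filter.not F1).and (Filter.not F2))

/-- The tautological filter ⊤ (`isNull` of the empty set of terms is always true). -/
def Filter.tru : Filter A Δ := .isNull []

/-- A tuple over a set of attributes: `none` marks attributes outside the set. -/
abbrev Tuple (A Δ : Type) := A → Option Δ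

mutual
/-- Evaluation of a term on a tuple (`null` is the distinguished null value of `Δ`). -/
def Term.eval (null : Δ) (t : Tuple A Δ) : Term A Δ → Δ
  | .attr a => (t a).getD null
  | .const c => c
  | .ite F v v' => if F.eval null t = TV.tt then v.eval null t else v'.eval null t

def Term.evalList (null : Δ) (t : Tuple A Δ) : List (Term A Δ) → List Δ
  | [] => []
  | v :: vs => v.eval null t :: Term.evalList null t vs

/-- Three-valued evaluation of a filter on a tuple. -/
def Filter.eval (null : Δ) (t : Tuple A Δ) : Filter A Δ → TV
  | .isNull V => if ∀ d ∈ Term.evalList null t V, d = null then .tt else .ff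
  | .eq v v' =>
      if v.eval null t = null ∨ v'.eval null t = null then .unk
      else if v.eval null t = v'.eval null t then .tt else .ff
  | .and F1 F2 => (F1.eval null t).and (F2.eval null t)
  | .not F => (F.eval null t).not
end

mutual
/-- Attributes occurring in a term. -/
def Term.attrs : Term A Δ → Finset A
  | .attr a => {a}
  | .const _ => ∅
  | .ite F v v' => F.attrs ∪ v.attrs ∪ v'.attrs

def Term.attrsList : List (Term A Δ) → Finset A
  | [] => ∅
  | v :: vs => v.attrs ∪ Term.attrsList vs

/-- Attributes occurring in a filter. -/
def Filter.attrs : Filter A Δ → Finset A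
  | .isNull V => Term.attrsList V
  | .eq v v' => v.attrs ∪ v'.attrs
  | .and F1 F2 => F1.attrs ∪ F2.attrs
  | .not F => F.attrs
end

/-- A term is over `U` if all its attributes are in `U`. -/
def Term.over (v : Term A Δ) (U : Finset A) : Prop := v.attrs ⊆ U

/-- A filter is over `U` if all its attributes are in `U`. -/
def Filter.over (F : Filter A Δ) (U : Finset A) : Prop := F.attrs ⊆ U

/-- A tuple is over `U` if its domain is exactly `U`. -/
def Tuple.isOver (t : Tuple A Δ) (U : Finset A) : Prop := ∀ a, (t a).isSome ↔ a ∈ U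

/-- A relation is a bag (multiset) of tuples. -/
abbrev Rel (A Δ : Type) := Multiset (Tuple A Δ)

/-- A relation is over `U` if all its tuples are. -/
def Rel.isOver (R : Rel A Δ) (U : Finset A) : Prop := ∀ t ∈ R, t.isOver U

/-- Selection σ_F. -/
def select (null : Δ) (F : Filter A Δ) (R : Rel A Δ) : Rel A Δ :=
  R.filter (fun t => F.eval null t = .tt)

/-- Restriction of a tuple to the attributes in `U`. -/
def Tuple.restrict (t : Tuple A Δ) (U : Finset A) : Tuple A Δ :=
  fun a => if a ∈ U then t a else none

/-- Projection π_U (bag semantics: multiplicities are added up). -/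
def proj (U : Finset A) (R : Rel A Δ) : Rel A Δ := R.map (·.restrict U)

/-- Bag difference: `(R1 ∖ R2)(t) = R1(t)` if `t ∉ R2` and `0` otherwise. -/
def bdiff (R1 R2 : Rel A Δ) : Rel A Δ := R1.filter (fun t => t ∉ R2)

/-- Compatibility of tuples: equal and non-null on the shared attributes. -/
def Compat (null : Δ) (t1 t2 : Tuple A Δ) : Prop :=
  ∀ a, (t1 a).isSome → (t2 a).isSome → (t1 a = t2 a ∧ t1 a ≠ some null)

/-- `t1 ⊕ t2`: the common extension of two (compatible) tuples. -/
def Tuple.merge (t1 t2 : Tuple A Δ) : Tuple A Δ :=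
  fun a => (t1 a).or (t2 a)

/-- Natural join. -/
def join (null : Δ) (R1 R2 : Rel A Δ) : Rel A Δ :=
  (R1.product R2).filterMap
    (fun p => if Compat null p.1 p.2 then some (p.1.merge p.2) else none)

/-- Natural join with a filter: `R1 ⋈_F R2 = σ_F (R1 ⋈ R2)`. -/
def joinF (null : Δ) (F : Filter A Δ) (R1 R2 : Rel A Δ) : Rel A Δ :=
  select null F (join null R1 R2)

/-- Padding of a tuple with `null` on the attributes of `V`. -/
def Tuple.pad (null : Δ) (V : Finset A) (t : Tuple A Δ) : Tuple A Δ :=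
  fun a => if a ∈ V then (t a).or (some null) else t a

/-- Outer union of `R1` over `U1` and `R2` over `U2`:
each relation is padded with nulls on the attributes missing from it. -/
def ounion (null : Δ) (U1 U2 : Finset A) (R1 R2 : Rel A Δ) : Rel A Δ :=
  R1.map (Tuple.pad null (U2 \ U1)) + R2.map (Tuple.pad null (U1 \ U2))

/-- Left join `R1 ⟕_F R2 = (R1 ⋈_F R2) ⊎ (R1 ∖ π_{U1}(R1 ⋈_F R2))`
for `R1` over `U1` and `R2` over `U2`. -/
def ljoin (null : Δ) (U1 U2 : Finset A) (F : Filter A Δ) (R1 R2 : Rel A Δ) : Rel A Δ :=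
  ounion null (U1 ∪ U2) U1 (joinF null F R1 R2) (bdiff R1 (proj U1 (joinF null F R1 R2)))

/-- Natural left join `R1 ⟕ R2 = R1 ⟕_⊤ R2`. -/
def nljoin (null : Δ) (U1 U2 : Finset A) (R1 R2 : Rel A Δ) : Rel A Δ :=
  ljoin null U1 U2 Filter.tru R1 R2

/-- Extension ν_{u↦v}. -/
def extend (null : Δ) (u : A) (v : Term A Δ) (R : Rel A Δ) : Rel A Δ :=
  R.map (fun t a => if a = u then some (v.eval null t) else t a)

/-- Duplicate elimination δ. -/
def dedup (R : Rel A Δ) : Rel A Δ := R.dedup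

/-- Extended renaming ρ^V_{{u/f(u) | u ∈ S}} at the level of tuples:
each attribute `u ∈ S` receives the value of the term `f u` (evaluated on the original
tuple) and the attributes of `V ∖ S` are projected away. -/
def renameFun (null : Δ) (V S : Finset A) (f : A → Term A Δ) (t : Tuple A Δ) : Tuple A Δ :=
  fun a => if a ∈ S then some ((f a).eval null t) else if a ∈ V then none else t a

/-- Extended renaming ρ^V_{{u/f(u) | u ∈ S}}. -/
def rename (null : Δ) (V S : Finset A) (f : A → Term A Δ) (R : Rel A Δ) : Rel A Δ :=
  R.map (renameFun null V S f)

/-- Renaming of the attribute `uold` into `unew` at the level of tuples. -/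
def renameAttrT (unew uold : A) (t : Tuple A Δ) : Tuple A Δ :=
  fun a => if a = unew then t uold else if a = uold then none else t a

/-- `R[unew/uold]`: the relation `R` with the attribute `uold` renamed to `unew`. -/
def renameAttr (unew uold : A) (R : Rel A Δ) : Rel A Δ := R.map (renameAttrT unew uold)

/-- `coalesce(v, v') = if(¬isNull(v), v, v')`. -/
def Term.coalesce (v v' : Term A Δ) : Term A Δ := .ite (.not (.isNull [v])) v v'

/-- The filter `⋀_{u ∈ K} ¬isNull(u)`. -/
def notNullAll (K : Finset A) : Filter A Δ :=
  K.toList.foldr (fun u acc => (Filter.not (.isNull [.attr u])).and acc) Filter.tru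

mutual
/-- `nullify_S`: replace every occurrence of an attribute from `S` by the constant null. -/
def Term.nullify (null : Δ) (S : Finset A) : Term A Δ → Term A Δ
  | .attr a => if a ∈ S then .const null else .attr a
  | .const c => .const c
  | .ite F v v' => .ite (F.nullify null S) (v.nullify null S) (v'.nullify null S)

def Term.nullifyList (null : Δ) (S : Finset A) : List (Term A Δ) → List (Term A Δ)
  | [] => []
  | v :: vs => v.nullify null S :: Term.nullifyList null S vs

/-- `nullify_S` on filters. -/
def Filter.nullify (null : Δ) (S : Finset A) : Filter A Δ → Filter A Δ
  | .isNull V => .isNull (Term.nullifyList null S V)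
  | .eq v v' => .eq (v.nullify null S) (v'.nullify null S)
  | .and F1 F2 => .and (F1.nullify null S) (F2.nullify null S)
  | .not F => .not (F.nullify null S)
end

/-- p-equivalence of filters over `U`: they are ⊤ on the same tuples over `U`. -/
def pequiv (null : Δ) (U : Finset A) (F1 F2 : Filter A Δ) : Prop :=
  ∀ t : Tuple A Δ, t.isOver U → (F1.eval null t = TV.tt ↔ F2.eval null t = TV.tt)

end RA

namespace RA

variable {A Δ : Type} [DecidableEq A] [DecidableEq Δ]

theorem TV.and_eq_tt {a b : TV} : a.and b = .tt ↔ a = .tt ∧ b = .tt := by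
  cases a <;> cases b <;> simp [TV.and]

omit [DecidableEq A] in
theorem Filter.eval_tru (null : Δ) (t : Tuple A Δ) :
    (Filter.tru : Filter A Δ).eval null t = .tt := by
  simp [Filter.tru, Filter.eval, Term.evalList]

omit [DecidableEq A] in
theorem Filter.eval_not_isNull_attr (null : Δ) (t : Tuple A Δ) (u : A) :
    (Filter.not (.isNull [.attr u])).eval null t = .tt ↔ (t u).getD null ≠ null := by
  by_cases hu : (t u).getD null = null <;>
    simp [Filter.eval, Term.evalList, Term.eval, TV.not, hu]

omit [DecidableEq A] in
theorem eval_notNullAll (null : Δ) (K : Finset A) (t : Tuple A Δ) :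
    (notNullAll K : Filter A Δ).eval null t = .tt ↔ ∀ u ∈ K, (t u).getD null ≠ null := by
  have key : ∀ l : List A,
      (l.foldr (fun u acc => (Filter.not (.isNull [.attr u])).and acc)
        (Filter.tru : Filter A Δ)).eval null t = .tt ↔ ∀ u ∈ l, (t u).getD null ≠ null := by
    intro l
    induction l with
    | nil => simpa using Filter.eval_tru null t
    | cons u l ih =>
      rw [List.foldr_cons, Filter.eval, TV.and_eq_tt, Filter.eval_not_isNull_attr, ih,
        List.forall_mem_cons]
  simpa only [notNullAll, Finset.mem_toList] using key K.toList

omit [DecidableEq A] in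
theorem select_tru (null : Δ) (R : Rel A Δ) : select null Filter.tru R = R :=
  Multiset.filter_eq_self.2 fun t _ => Filter.eval_tru null t

omit [DecidableEq A] [DecidableEq Δ] in
theorem cons_join (null : Δ) (t : Tuple A Δ) (R1 R2 : Rel A Δ) :
    join null (t ::ₘ R1) R2 = join null {t} R2 + join null R1 R2 := by
  simp only [join, Multiset.product]
  rw [Multiset.cons_bind, Multiset.singleton_bind, Multiset.filterMap_add]

omit [DecidableEq A] [DecidableEq Δ] in
theorem mem_join {null : Δ} {R1 R2 : Rel A Δ} {t : Tuple A Δ} :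
    t ∈ join null R1 R2 ↔ ∃ t1 ∈ R1, ∃ t2 ∈ R2, Compat null t1 t2 ∧ t1.merge t2 = t := by
  rw [join, Multiset.mem_filterMap]
  constructor
  · rintro ⟨⟨t1, t2⟩, hp, ht⟩
    have hp := Multiset.mem_product.1 hp
    by_cases hc : Compat null t1 t2
    · exact ⟨t1, hp.1, t2, hp.2, hc, by simpa [hc] using ht⟩
    · simp [hc] at ht
  · rintro ⟨t1, h1, t2, h2, hc, rfl⟩
    exact ⟨(t1, t2), Multiset.mem_product.2 ⟨h1, h2⟩, by simp [hc]⟩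

omit [DecidableEq A] in
/-- Selecting the left operand changes nothing if only dangling tuples are removed. -/
theorem join_select_left (null : Δ) (F : Filter A Δ) (R1 R2 : Rel A Δ)
    (hF : ∀ t1 ∈ R1, ∀ t2 ∈ R2, Compat null t1 t2 → F.eval null t1 = .tt) :
    join null (select null F R1) R2 = join null R1 R2 := by
  induction R1 using Multiset.induction_on with
  | empty => simp [select]
  | cons t R1 ih =>
    have ih := ih fun t1 h1 => hF t1 (Multiset.mem_cons_of_mem h1)
    unfold select at ih ⊢
    by_cases ht : F.eval null t = .tt
    · rw [Multiset.filter_cons_of_pos (p := fun t => F.eval null t = .tt) _ ht, cons_join,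
        ih, cons_join null t R1]
    · have hd : join null {t} R2 = 0 := Multiset.eq_zero_of_forall_notMem fun s hs => by
        obtain ⟨t1, h1, t2, h2, hc, -⟩ := mem_join.1 hs
        obtain rfl := Multiset.mem_singleton.1 h1
        exact ht (hF t1 (Multiset.mem_cons_self _ _) t2 h2 hc)
      rw [Multiset.filter_cons_of_neg (p := fun t => F.eval null t = .tt) _ ht, ih,
        cons_join null t R1, hd, zero_add]

omit [DecidableEq Δ] in
theorem Tuple.restrict_merge_left {t1 : Tuple A Δ} {U1 : Finset A} (h1 : t1.isOver U1)
    (t2 : Tuple A Δ) : (t1.merge t2).restrict U1 = t1 := by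
  funext a
  by_cases ha : a ∈ U1
  · obtain ⟨d, hd⟩ := Option.isSome_iff_exists.1 ((h1 a).2 ha)
    simp [Tuple.restrict, Tuple.merge, ha, hd]
  · have hn : t1 a = none := by simpa [ha] using h1 a
    simp [Tuple.restrict, ha, hn]

omit [DecidableEq Δ] in
theorem Compat.getD_ne {null : Δ} {t1 t2 : Tuple A Δ} {U1 U2 : Finset A}
    (hc : Compat null t1 t2) (h1 : t1.isOver U1) (h2 : t2.isOver U2) :
    ∀ u ∈ U1 ∩ U2, (t1 u).getD null ≠ null := by
  intro u hu
  obtain ⟨hu1, hu2⟩ := Finset.mem_inter.1 hu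
  have hne := (hc u ((h1 u).2 hu1) ((h2 u).2 hu2)).2
  obtain ⟨d, hd⟩ := Option.isSome_iff_exists.1 ((h1 u).2 hu1)
  simpa [hd] using hne

omit [DecidableEq Δ] in
theorem compat_of_restrict_eq {null : Δ} {t1 t2 : Tuple A Δ} {U1 U2 : Finset A}
    (h1 : t1.isOver U1) (h2 : t2.isOver U2)
    (hr : t2.restrict (U1 ∩ U2) = t1.restrict (U1 ∩ U2))
    (hn : ∀ u ∈ U1 ∩ U2, (t1 u).getD null ≠ null) : Compat null t1 t2 := by
  intro a ha1 ha2
  have hK : a ∈ U1 ∩ U2 := Finset.mem_inter.2 ⟨(h1 a).1 ha1, (h2 a).1 ha2⟩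
  have ha : t2 a = t1 a := by
    have := congrFun hr a
    rwa [Tuple.restrict, Tuple.restrict, if_pos hK, if_pos hK] at this
  exact ⟨ha.symm, fun he => hn a hK (by simp [he])⟩

theorem ljoin_eq_joinF (null : Δ) (U1 U2 : Finset A) (F : Filter A Δ) (R1 R2 : Rel A Δ)
    (h : ∀ t ∈ R1, t ∈ proj U1 (joinF null F R1 R2)) :
    ljoin null U1 U2 F R1 R2 = joinF null F R1 R2 := by
  have hd : bdiff R1 (proj U1 (joinF null F R1 R2)) = 0 :=
    Multiset.filter_eq_nil.2 fun t ht hn => hn (h t ht)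
  have hp : Tuple.pad null (U1 \ (U1 ∪ U2)) = (id : Tuple A Δ → Tuple A Δ) := by
    funext t a
    have ha : a ∉ U1 \ (U1 ∪ U2) := by simp +contextual
    simp only [Tuple.pad, if_neg ha, id]
  rw [ljoin, ounion, hd, hp, Multiset.map_id, Multiset.map_zero, add_zero]

theorem stmt12 (null : Δ) (U1 U2 : Finset A) (R1 R2 : Rel A Δ)
    (hR1 : R1.isOver U1) (hR2 : R2.isOver U2)
    (h : dedup (proj (U1 ∩ U2) R1) ≤ proj (U1 ∩ U2) R2) :
    nljoin null U1 U2 (select null (notNullAll (U1 ∩ U2)) R1) R2 = join null R1 R2 := by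
  have hjoin : join null (select null (notNullAll (U1 ∩ U2)) R1) R2 = join null R1 R2 :=
    join_select_left null _ R1 R2 fun t1 h1 t2 h2 hc =>
      (eval_notNullAll null _ t1).2 (hc.getD_ne (hR1 t1 h1) (hR2 t2 h2))
  have hjoinF : joinF null Filter.tru (select null (notNullAll (U1 ∩ U2)) R1) R2 =
      join null R1 R2 := by
    rw [joinF, select_tru, hjoin]
  rw [nljoin, ljoin_eq_joinF, hjoinF]
  intro t ht
  obtain ⟨ht1, hF⟩ := Multiset.mem_filter.1 ht
  have hK : t.restrict (U1 ∩ U2) ∈ proj (U1 ∩ U2) R2 :=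
    Multiset.mem_of_le h (Multiset.mem_dedup.2 (Multiset.mem_map_of_mem _ ht1))
  obtain ⟨t2, ht2, hr⟩ := Multiset.mem_map.1 hK
  have hc : Compat null t t2 := compat_of_restrict_eq (hR1 t ht1) (hR2 t2 ht2) hr
    ((eval_notNullAll null _ t).1 hF)
  rw [hjoinF]
  exact Multiset.mem_map.2 ⟨t.merge t2, mem_join.2 ⟨t, ht1, t2, ht2, hc, rfl⟩,
    Tuple.restrict_merge_left (hR1 t ht1) t2⟩

end RA
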